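/- Product formula for the even trigonometric collocation coefficients: for every x ∈ ℝ and every j ∈ ℕ, ∫₀¹ φ₀((1−ξ)²x) p̂_{2j}(ξ) dξ = √(4j+1) · (−1)ʲ ( (2j)! / (4j+1)! ) xʲ · ( Σ_{l≥0} (−x/16)ˡ / ( (1/2)ₗ l! ) ) · ( Σ_{l≥0} (−x/16)ˡ / ( (2j+3/2)ₗ l! ) ). -/

import Mathlib

/-- The shifted Legendre polynomial of degree `j` on `[0,1]`,
`p̂ⱼ(τ) = (-1)ʲ √(2j+1) Σ_{k=0}^{j} C(j,k) C(j+k,k) (-τ)ᵏ`. -/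
noncomputable def legendreShifted (j : ℕ) (τ : ℝ) : ℝ :=
  (-1 : ℝ) ^ j * Real.sqrt (2 * j + 1) *
    ∑ k ∈ Finset.range (j + 1),
      (j.choose k : ℝ) * ((j + k).choose k : ℝ) * (-τ) ^ k

/-- `φ₀(x) = Σ_{l≥0} (-1)ˡ xˡ/(2l)!` for `x ∈ ℝ`. -/
noncomputable def phiZeroReal (x : ℝ) : ℝ :=
  ∑' l : ℕ, (-1 : ℝ) ^ l * x ^ l / (Nat.factorial (2 * l) : ℝ)

/-- The Chu–Vandermonde binomial `Ring.choose` in terms of rising factorials. -/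
lemma factorial_mul_choose_eq_ascPochhammer_eval (r : ℝ) (k : ℕ) :
    (k.factorial : ℝ) * Ring.choose r k = (ascPochhammer ℝ k).eval (r - k + 1) := by
  rw [← nsmul_eq_mul, ← Ring.descPochhammer_eq_factorial_smul_choose,
    Polynomial.descPochhammer_smeval_eq_ascPochhammer, Polynomial.ascPochhammer_smeval_eq_eval]

lemma ascPochhammer_eval_mul_eval_add (a : ℝ) (k l : ℕ) :
    (ascPochhammer ℝ k).eval a * (ascPochhammer ℝ l).eval (a + k) =
      (ascPochhammer ℝ (k + l)).eval a := by
  rw [← ascPochhammer_mul]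
  simp

lemma inv_ascPochhammer_eq_choose_div {a : ℝ} (ha : 0 < a) (k l : ℕ) :
    ((ascPochhammer ℝ k).eval a)⁻¹ =
      l.factorial * Ring.choose (a + (k + l : ℕ) - 1) l / (ascPochhammer ℝ (k + l)).eval a := by
  rw [factorial_mul_choose_eq_ascPochhammer_eval, ← ascPochhammer_eval_mul_eval_add,
    show a + (k + l : ℕ) - 1 - l + 1 = a + k by push_cast; ring]
  have h1 := ascPochhammer_pos k a ha
  have h2 := ascPochhammer_pos l (a + k) (by positivity)
  field_simp

/-- Coefficients of the product `₀F₁(; a; y) ₀F₁(; b; y)`. -/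
lemma sum_antidiagonal_inv_ascPochhammer_mul {a b : ℝ} (ha : 0 < a) (hb : 0 < b) (n : ℕ) :
    ∑ p ∈ Finset.HasAntidiagonal.antidiagonal n,
      (1 / ((ascPochhammer ℝ p.1).eval a * (p.1.factorial : ℝ))) *
        (1 / ((ascPochhammer ℝ p.2).eval b * (p.2.factorial : ℝ))) =
      (ascPochhammer ℝ n).eval (a + b + n - 1) /
        (n.factorial * (ascPochhammer ℝ n).eval a * (ascPochhammer ℝ n).eval b) := by
  have hA := ascPochhammer_pos n a ha
  have hB := ascPochhammer_pos n b hb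
  have hV := Ring.add_choose_eq n (Commute.all (b + (n : ℝ) - 1) (a + (n : ℝ) - 1))
  have hterm : ∀ p ∈ Finset.HasAntidiagonal.antidiagonal n,
      (1 / ((ascPochhammer ℝ p.1).eval a * (p.1.factorial : ℝ))) *
        (1 / ((ascPochhammer ℝ p.2).eval b * (p.2.factorial : ℝ))) =
      Ring.choose (b + (n : ℝ) - 1) p.1 * Ring.choose (a + (n : ℝ) - 1) p.2 /
        ((ascPochhammer ℝ n).eval a * (ascPochhammer ℝ n).eval b) := by
    rintro ⟨k, l⟩ h
    rw [Finset.HasAntidiagonal.mem_antidiagonal] at h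
    have hk := inv_ascPochhammer_eq_choose_div ha k l
    have hl := inv_ascPochhammer_eq_choose_div hb l k
    rw [h] at hk
    rw [add_comm l k, h] at hl
    dsimp only
    rw [one_div, one_div, mul_inv, mul_inv, hk, hl]
    have := k.factorial_ne_zero
    have := l.factorial_ne_zero
    field_simp
  rw [Finset.sum_congr rfl hterm, ← Finset.sum_div, ← hV]
  have h := factorial_mul_choose_eq_ascPochhammer_eval (b + (n : ℝ) - 1 + (a + (n : ℝ) - 1)) n
  rw [show b + (n : ℝ) - 1 + (a + (n : ℝ) - 1) - n + 1 = a + b + n - 1 by ring] at h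
  rw [← h]
  have := n.factorial_ne_zero
  field_simp

lemma ascPochhammer_eval_one_half (n : ℕ) :
    (ascPochhammer ℝ n).eval (1 / 2 : ℝ) * n.factorial * 4 ^ n = ((2 * n).factorial : ℝ) := by
  induction n with
  | zero => simp
  | succ n ih =>
    rw [ascPochhammer_succ_eval, show 2 * (n + 1) = 2 * n + 1 + 1 by ring]
    simp only [Nat.factorial_succ]
    push_cast
    rw [← ih]
    ring

lemma ascPochhammer_eval_add_three_halves (N n : ℕ) :
    (ascPochhammer ℝ n).eval ((N : ℝ) + 3 / 2) * (N + n).factorial * (2 * N + 1).factorial * 4 ^ n =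
      ((2 * N + 1 + 2 * n).factorial : ℝ) * N.factorial := by
  induction n with
  | zero => simp [mul_comm]
  | succ n ih =>
    rw [ascPochhammer_succ_eval, show 2 * N + 1 + 2 * (n + 1) = 2 * N + 1 + 2 * n + 1 + 1 by ring,
      ← add_assoc, Nat.factorial_succ (2 * N + 1 + 2 * n + 1),
      Nat.factorial_succ (2 * N + 1 + 2 * n), Nat.factorial_succ (N + n)]
    push_cast
    linear_combination (2 * (N : ℝ) + 1 + 2 * n + 1 + 1) * (2 * (N : ℝ) + 1 + 2 * n + 1) * ih

lemma integral_pow_mul_one_sub_pow (k m : ℕ) :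
    ∫ t in (0 : ℝ)..1, t ^ k * (1 - t) ^ m =
      (k.factorial : ℝ) * m.factorial / (k + m + 1).factorial := by
  induction k generalizing m with
  | zero =>
    have h := intervalIntegral.integral_comp_sub_left (fun t : ℝ => t ^ m) (a := 0) (b := 1) 1
    simp only [pow_zero, one_mul]
    rw [h, integral_pow, zero_add, Nat.factorial_succ]
    have := m.factorial_ne_zero
    push_cast
    simp
    field_simp
  | succ k ih =>
    have hd : ∀ t ∈ Set.uIcc (0 : ℝ) 1, HasDerivAt (fun t : ℝ => t ^ (k + 1) * (1 - t) ^ (m + 1))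
        ((k + 1) * (t ^ k * (1 - t) ^ (m + 1)) - (m + 1) * (t ^ (k + 1) * (1 - t) ^ m)) t := by
      intro t _
      have h1 := hasDerivAt_pow (k + 1) t
      have h2 := ((hasDerivAt_id t).const_sub 1).pow (m + 1)
      convert! h1.mul h2 using 1
      push_cast
      simp
      ring
    have h := intervalIntegral.integral_eq_sub_of_hasDerivAt hd
      (Continuous.intervalIntegrable (by fun_prop) _ _)
    rw [intervalIntegral.integral_sub (Continuous.intervalIntegrable (by fun_prop) _ _)
      (Continuous.intervalIntegrable (by fun_prop) _ _), intervalIntegral.integral_const_mul,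
      intervalIntegral.integral_const_mul, ih, show k + (m + 1) + 1 = k + 1 + m + 1 by ring,
      Nat.factorial_succ m] at h
    rw [Nat.factorial_succ k]
    have := (k + 1 + m + 1).factorial_ne_zero
    have hm : (m + 1 : ℝ) ≠ 0 := by positivity
    apply mul_left_cancel₀ hm
    push_cast at h ⊢
    simp at h
    linear_combination -h

/-- Iterated differences of a quotient of factorials. -/
lemma sum_neg_one_pow_choose_mul_factorial_div (n a b : ℕ) :
    ∑ k ∈ Finset.range (n + 1),
      (-1 : ℝ) ^ k * n.choose k * ((a + k).factorial / (b + k).factorial) =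
      (ascPochhammer ℝ n).eval ((b : ℝ) - a) * a.factorial / (b + n).factorial := by
  induction n generalizing a b with
  | zero => simp
  | succ n ih =>
    have hP : ∑ k ∈ Finset.range (n + 1 + 1),
        (-1 : ℝ) ^ k * (n + 1).choose k * ((a + k).factorial / (b + k).factorial) =
        (∑ k ∈ Finset.range (n + 1),
          (-1 : ℝ) ^ k * n.choose k * ((a + k).factorial / (b + k).factorial)) -
        ∑ k ∈ Finset.range (n + 1),
          (-1 : ℝ) ^ k * n.choose k * ((a + 1 + k).factorial / (b + 1 + k).factorial) := by
      have hE : ∑ k ∈ Finset.range (n + 1),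
          (-1 : ℝ) ^ k * n.choose k * ((a + k).factorial / (b + k).factorial) =
          ∑ k ∈ Finset.range (n + 1 + 1),
          (-1 : ℝ) ^ k * n.choose k * ((a + k).factorial / (b + k).factorial) := by
        rw [Finset.sum_range_succ _ (n + 1)]
        simp
      rw [hE, Finset.sum_range_succ', Finset.sum_range_succ' _ (n + 1), add_sub_right_comm,
        ← Finset.sum_sub_distrib]
      congr 1
      · refine Finset.sum_congr rfl fun k _ => ?_
        rw [Nat.choose_succ_succ, add_right_comm a 1 k, add_right_comm b 1 k, ← add_assoc,
          ← add_assoc]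
        push_cast
        ring
      · simp
    rw [hP, ih, ih, ascPochhammer_succ_eval, add_right_comm b 1 n, ← add_assoc,
      Nat.factorial_succ (b + n), Nat.factorial_succ a]
    have := (b + n).factorial_ne_zero
    have : (b + n + 1 : ℝ) ≠ 0 := by positivity
    push_cast
    rw [show (b + 1 - (a + 1) : ℝ) = b - a by ring]
    field_simp
    ring

lemma continuous_legendreShifted (n : ℕ) : Continuous (legendreShifted n) := by
  unfold legendreShifted
  fun_prop

lemma integral_one_sub_pow_mul_legendreShifted (n m : ℕ) :
    ∫ t in (0 : ℝ)..1, (1 - t) ^ m * legendreShifted n t =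
      (-1 : ℝ) ^ n * Real.sqrt (2 * n + 1) *
        (m.factorial * m.descFactorial n / (m + n + 1).factorial) := by
  have h1 : ∀ t : ℝ, (1 - t) ^ m * legendreShifted n t =
      (-1 : ℝ) ^ n * Real.sqrt (2 * n + 1) * ∑ k ∈ Finset.range (n + 1),
        ((-1 : ℝ) ^ k * n.choose k * (n + k).choose k) * (t ^ k * (1 - t) ^ m) := by
    intro t
    rw [legendreShifted, mul_left_comm, Finset.mul_sum]
    congr 1
    refine Finset.sum_congr rfl fun k _ => ?_
    rw [neg_pow]
    ring
  have hd : (ascPochhammer ℝ n).eval (((m + 1 : ℕ) : ℝ) - n) = m.descFactorial n := by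
    rw [← descPochhammer_eval_eq_descFactorial, descPochhammer_eval_eq_ascPochhammer]
    congr 1
    push_cast
    ring
  have hS := sum_neg_one_pow_choose_mul_factorial_div n n (m + 1)
  rw [hd] at hS
  simp_rw [h1]
  rw [intervalIntegral.integral_const_mul, intervalIntegral.integral_finsetSum
    fun k _ => Continuous.intervalIntegrable (by fun_prop) _ _]
  congr 1
  have hn : (n.factorial : ℝ) ≠ 0 := by exact_mod_cast n.factorial_ne_zero
  calc _ = (m.factorial / n.factorial : ℝ) * ∑ k ∈ Finset.range (n + 1),
        (-1 : ℝ) ^ k * n.choose k * ((n + k).factorial / (m + 1 + k).factorial) := by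
        rw [Finset.mul_sum]
        refine Finset.sum_congr rfl fun k _ => ?_
        have hk : ((n + k).choose k : ℝ) * k.factorial * n.factorial = (n + k).factorial := by
          rw [← Nat.choose_symm_add, add_comm n k]
          exact_mod_cast Nat.add_choose_mul_factorial_mul_factorial k n
        rw [intervalIntegral.integral_const_mul, integral_pow_mul_one_sub_pow, ← hk,
          show k + m + 1 = m + 1 + k by ring]
        field_simp
    _ = _ := by
        rw [hS, add_right_comm]
        field_simp

lemma summable_pow_div_factorial_two_mul (x : ℝ) :
    Summable fun l : ℕ => |x| ^ l / ((2 * l).factorial : ℝ) := by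
  refine Summable.of_nonneg_of_le (fun l => by positivity) (fun l => ?_)
    (Real.summable_pow_div_factorial |x|)
  gcongr
  omega

/-- Termwise integration of `φ₀((1-t)²x)` against a continuous weight. -/
lemma hasSum_integral_phiZeroReal_mul (x : ℝ) {p : ℝ → ℝ} (hp : Continuous p) :
    HasSum (fun l : ℕ => (-1 : ℝ) ^ l * x ^ l / ((2 * l).factorial : ℝ) *
        ∫ t in (0 : ℝ)..1, (1 - t) ^ (2 * l) * p t)
      (∫ t in (0 : ℝ)..1, phiZeroReal ((1 - t) ^ 2 * x) * p t) := by
  obtain ⟨C, hC⟩ := isCompact_Icc.exists_bound_of_continuousOn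
    (hp.continuousOn (s := Set.Icc (0 : ℝ) 1))
  have hb : ∀ t ∈ Set.uIoc (0 : ℝ) 1, ∀ l : ℕ,
      ‖(-1 : ℝ) ^ l * ((1 - t) ^ 2 * x) ^ l / ((2 * l).factorial : ℝ)‖ ≤
        |x| ^ l / ((2 * l).factorial : ℝ) := by
    intro t ht l
    rw [Set.uIoc_of_le zero_le_one] at ht
    rw [norm_div, norm_mul, norm_pow, norm_pow, norm_mul, norm_pow, Real.norm_natCast, norm_neg,
      norm_one, one_pow, one_mul, Real.norm_eq_abs, Real.norm_eq_abs]
    have h1 : |1 - t| ≤ 1 := abs_le.2 ⟨by linarith [ht.2], by linarith [ht.1]⟩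
    have h2 : |1 - t| ^ 2 * |x| ≤ |x| :=
      mul_le_of_le_one_left (abs_nonneg x) (pow_le_one₀ (abs_nonneg _) h1)
    gcongr
  have key : HasSum (fun l : ℕ => ∫ t in (0 : ℝ)..1,
        (-1 : ℝ) ^ l * ((1 - t) ^ 2 * x) ^ l / ((2 * l).factorial : ℝ) * p t)
      (∫ t in (0 : ℝ)..1, phiZeroReal ((1 - t) ^ 2 * x) * p t) := by
    refine intervalIntegral.hasSum_integral_of_dominated_convergence
      (fun l _ => |x| ^ l / ((2 * l).factorial : ℝ) * C) (fun l => ?_) (fun l => ?_) ?_ ?_ ?_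
    · exact Continuous.aestronglyMeasurable (by fun_prop)
    · refine Filter.Eventually.of_forall fun t ht => ?_
      rw [norm_mul]
      have hpt : ‖p t‖ ≤ C := by
        rw [Set.uIoc_of_le zero_le_one] at ht
        exact hC t (Set.Ioc_subset_Icc_self ht)
      exact mul_le_mul (hb t ht l) hpt (norm_nonneg _) (by positivity)
    · exact Filter.Eventually.of_forall fun t _ =>
        (summable_pow_div_factorial_two_mul x).mul_right C
    · exact intervalIntegrable_const
    · refine Filter.Eventually.of_forall fun t ht => ?_
      exact (Summable.of_norm_bounded (summable_pow_div_factorial_two_mul x)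
        (hb t ht)).hasSum.mul_right (p t)
  convert! key using 2 with l
  rw [← intervalIntegral.integral_const_mul]
  congr 1
  ext t
  rw [mul_pow, ← pow_mul]
  ring

lemma summable_norm_pow_div_ascPochhammer_mul_factorial (y : ℝ) {a : ℝ} (ha : 1 / 2 ≤ a) :
    Summable fun l : ℕ => ‖y ^ l / ((ascPochhammer ℝ l).eval a * (l.factorial : ℝ))‖ := by
  have hP : ∀ l : ℕ, (1 / 2 : ℝ) ^ l ≤ (ascPochhammer ℝ l).eval a := by
    intro l
    induction l with
    | zero => simp
    | succ l ih =>
      rw [ascPochhammer_succ_eval, pow_succ]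
      have : (0 : ℝ) ≤ l := by positivity
      exact mul_le_mul ih (by linarith) (by norm_num) ((by positivity : (0 : ℝ) ≤ _).trans ih)
  refine Summable.of_nonneg_of_le (fun l => norm_nonneg _) (fun l => ?_)
    (Real.summable_pow_div_factorial (2 * |y|))
  have h0 : (0 : ℝ) < (1 / 2) ^ l := by positivity
  have h1 := h0.trans_le (hP l)
  have h2 : (0 : ℝ) < l.factorial := by positivity
  rw [norm_div, norm_pow, Real.norm_eq_abs, Real.norm_of_nonneg (by positivity),
    show (2 * |y|) ^ l / (l.factorial : ℝ) = |y| ^ l / ((1 / 2) ^ l * l.factorial) by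
      rw [mul_pow, one_div, inv_pow]; field_simp]
  gcongr
  exact hP l

/-- The product `₀F₁(; 1/2; -x/16) ₀F₁(; N + 3/2; -x/16)` as a power series in `x`. -/
lemma tsum_mul_tsum_ascPochhammer (x : ℝ) (N : ℕ) :
    (∑' l : ℕ, (-x / 16) ^ l /
        ((ascPochhammer ℝ l).eval (1 / 2 : ℝ) * (Nat.factorial l : ℝ))) *
      (∑' l : ℕ, (-x / 16) ^ l /
        ((ascPochhammer ℝ l).eval ((N : ℝ) + 3 / 2) * (Nat.factorial l : ℝ))) =
      ∑' n : ℕ, (-x) ^ n * ((N + 2 * n).factorial * (2 * N + 1).factorial /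
        ((2 * n).factorial * (2 * N + 1 + 2 * n).factorial * N.factorial)) := by
  have hN : (0 : ℝ) ≤ N := by positivity
  rw [tsum_mul_tsum_eq_tsum_sum_antidiagonal_of_summable_norm
    (summable_norm_pow_div_ascPochhammer_mul_factorial _ le_rfl)
    (summable_norm_pow_div_ascPochhammer_mul_factorial _ (by linarith))]
  congr 1
  ext n
  have hc := sum_antidiagonal_inv_ascPochhammer_mul (a := 1 / 2) (b := N + 3 / 2)
    (by norm_num) (by linarith) n
  have hA := ascPochhammer_eval_one_half n
  have hB := ascPochhammer_eval_add_three_halves N n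
  have hD := factorial_mul_ascPochhammer ℝ (N + n) n
  rw [show (1 / 2 + (N + 3 / 2) + n - 1 : ℝ) = (N + n : ℕ) + 1 by push_cast; ring] at hc
  rw [show N + n + n = N + 2 * n by ring] at hD
  have hApos := ascPochhammer_pos n (1 / 2 : ℝ) (by norm_num)
  have hBpos := ascPochhammer_pos n ((N : ℝ) + 3 / 2) (by linarith)
  calc _ = (-x / 16) ^ n * ∑ p ∈ Finset.HasAntidiagonal.antidiagonal n,
      (1 / ((ascPochhammer ℝ p.1).eval (1 / 2 : ℝ) * (p.1.factorial : ℝ))) *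
        (1 / ((ascPochhammer ℝ p.2).eval ((N : ℝ) + 3 / 2) * (p.2.factorial : ℝ))) := by
        rw [Finset.mul_sum]
        refine Finset.sum_congr rfl fun p hp => ?_
        rw [← Finset.HasAntidiagonal.mem_antidiagonal.1 hp, pow_add]
        ring
    _ = _ := by
        rw [hc, ← hA, ← hD, mul_assoc (_ * _ : ℝ), ← hB, div_pow,
          show (16 : ℝ) = 4 * 4 by norm_num, mul_pow]
        have := n.factorial_ne_zero
        have := (N + n).factorial_ne_zero
        have := (2 * N + 1).factorial_ne_zero
        field_simp

/-- **product formula for the even trigonometric collocation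
coefficients.** For every `x ∈ ℝ` and `j ∈ ℕ`,
`∫₀¹ φ₀((1-ξ)²x) p̂_{2j}(ξ) dξ = √(4j+1) (-1)ʲ ((2j)!/(4j+1)!) xʲ
  (Σ_{l≥0} (-x/16)ˡ/((1/2)ₗ l!)) (Σ_{l≥0} (-x/16)ˡ/((2j+3/2)ₗ l!))`,
where `(a)ₗ` is the Pochhammer symbol. -/
theorem trigonometric_collocation_coefficient_even
    (x : ℝ) (j : ℕ) :
    (∫ ξ in (0 : ℝ)..1, phiZeroReal ((1 - ξ) ^ 2 * x) * legendreShifted (2 * j) ξ)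
      = Real.sqrt (4 * j + 1) *
          ((-1 : ℝ) ^ j *
            ((Nat.factorial (2 * j) : ℝ) / (Nat.factorial (4 * j + 1) : ℝ)) * x ^ j) *
          (∑' l : ℕ, (-x / 16) ^ l /
            ((ascPochhammer ℝ l).eval (1 / 2 : ℝ) * (Nat.factorial l : ℝ))) *
          (∑' l : ℕ, (-x / 16) ^ l /
            ((ascPochhammer ℝ l).eval ((2 * j : ℝ) + 3 / 2) * (Nat.factorial l : ℝ))) := by
  have hI := hasSum_integral_phiZeroReal_mul x (continuous_legendreShifted (2 * j))
  have hs := hI.summable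
  rw [← hI.tsum_eq, ← hs.sum_add_tsum_nat_add j, Finset.sum_eq_zero, zero_add, mul_assoc]
  · have hP := tsum_mul_tsum_ascPochhammer x (2 * j)
    push_cast at hP
    rw [hP, ← tsum_mul_left]
    congr 1
    ext n
    have hf : ((2 * n).factorial : ℝ) * (2 * (n + j)).descFactorial (2 * j) =
        (2 * (n + j)).factorial := by
      have := Nat.factorial_mul_descFactorial (show 2 * j ≤ 2 * (n + j) by omega)
      rw [show 2 * (n + j) - 2 * j = 2 * n by omega] at this
      exact_mod_cast this
    rw [integral_one_sub_pow_mul_legendreShifted,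
      show 2 * (n + j) + 2 * j + 1 = 4 * j + 1 + 2 * n by ring,
      show 2 * (2 * j) + 1 + 2 * n = 4 * j + 1 + 2 * n by ring,
      show 2 * (2 * j) + 1 = 4 * j + 1 by ring, show 2 * j + 2 * n = 2 * (n + j) by ring, ← hf,
      (even_two_mul j).neg_one_pow, neg_pow x n, pow_add, pow_add]
    have : ((2 * (n + j)).factorial : ℝ) ≠ 0 := by positivity
    rw [← hf] at this
    push_cast
    rw [show (2 * (2 * j) + 1 : ℝ) = 4 * j + 1 by ring]
    field_simp
  · intro l hl
    rw [integral_one_sub_pow_mul_legendreShifted, Nat.descFactorial_of_lt]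
    · simp
    · have := Finset.mem_range.1 hl
      omega
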